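/- Let k be a field of characteristic different from 2 and let (α,β,γ) ∈ k³. Write M for the free right A(α,β,γ)-module A(α,β,γ)⁴ with standard basis e₀, e₁, e₂, e₃. Then there do not exist k-algebra endomorphisms ν₀, ν₁, ν₂, ν₃ of A(α,β,γ) and a k-linear map d : A(α,β,γ) → M such that d(x_i) = e_i for i = 0,1,2,3 and, for all a, b ∈ A(α,β,γ) and each component j, d(ab)_j = d(a)_j·b + ν_j(a)·d(b)_j (i.e. d satisfies the Leibniz rule with respect to the left module structure a·e_j := e_j·ν_j(a)). Consequently the four-dimensional Sklyanin algebras admit no first-order differential calculus of this form. -/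

import Mathlib

noncomputable section

variable (k : Type*) [Field k]

/-- The generators `x₀, x₁, x₂, x₃` of the free algebra `k⟨x₀,x₁,x₂,x₃⟩`. -/
def g4 (i : Fin 4) : FreeAlgebra k (Fin 4) := FreeAlgebra.ι k i

/-- The relation whose induced ring quotient is the quotient of `k⟨x₀,x₁,x₂,x₃⟩` by the
two-sided ideal generated by the six defining elements of `A(α,β,γ)`. -/
def fourRel (α β γ : k) : FreeAlgebra k (Fin 4) → FreeAlgebra k (Fin 4) → Prop := fun a b =>
  b = 0 ∧
    (a = g4 k 0 * g4 k 1 - g4 k 1 * g4 k 0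
          - algebraMap k _ α * (g4 k 2 * g4 k 3 + g4 k 3 * g4 k 2) ∨
     a = g4 k 0 * g4 k 1 + g4 k 1 * g4 k 0 - (g4 k 2 * g4 k 3 - g4 k 3 * g4 k 2) ∨
     a = g4 k 0 * g4 k 2 - g4 k 2 * g4 k 0
          - algebraMap k _ β * (g4 k 3 * g4 k 1 + g4 k 1 * g4 k 3) ∨
     a = g4 k 0 * g4 k 2 + g4 k 2 * g4 k 0 - (g4 k 3 * g4 k 1 - g4 k 1 * g4 k 3) ∨
     a = g4 k 0 * g4 k 3 - g4 k 3 * g4 k 0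
          - algebraMap k _ γ * (g4 k 1 * g4 k 2 + g4 k 2 * g4 k 1) ∨
     a = g4 k 0 * g4 k 3 + g4 k 3 * g4 k 0 - (g4 k 1 * g4 k 2 - g4 k 2 * g4 k 1))

/-- The algebra `A(α,β,γ)`; when `α+β+γ+αβγ = 0` this is the four-dimensional Sklyanin
algebra `S(α,β,γ)`. -/
abbrev SklyA (α β γ : k) : Type _ := RingQuot (fourRel k α β γ)

/-- The images of the generators `x₀, x₁, x₂, x₃` in `A(α,β,γ)`. -/
def agen (α β γ : k) (i : Fin 4) : SklyA k α β γ :=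
  RingQuot.mkAlgHom k (fourRel k α β γ) (g4 k i)

/-- The character of `A(α,β,γ)` with `x₁ ↦ 1` and `xᵢ ↦ 0` for `i ≠ 1`. It exists because the
defining relations only involve products of distinct generators. -/
def evalOne (α β γ : k) : SklyA k α β γ →ₐ[k] k :=
  RingQuot.liftAlgHom k ⟨FreeAlgebra.lift k (Pi.single 1 1 : Fin 4 → k), by
    rintro a b ⟨rfl, rfl | rfl | rfl | rfl | rfl | rfl⟩ <;> simp [g4]⟩

theorem agen_one_ne_zero (α β γ : k) : agen k α β γ 1 ≠ 0 := fun h => by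
  simpa [agen, evalOne, g4] using congrArg (evalOne k α β γ) h

theorem agen_commutator (α β γ : k) :
    agen k α β γ 0 * agen k α β γ 1 - agen k α β γ 1 * agen k α β γ 0 =
      α • (agen k α β γ 2 * agen k α β γ 3 + agen k α β γ 3 * agen k α β γ 2) := by
  have h := RingQuot.mkAlgHom_rel k (s := fourRel k α β γ) ⟨rfl, Or.inl rfl⟩
  rw [map_zero] at h
  simpa [agen, sub_eq_zero, Algebra.smul_def] using h

theorem agen_anticommutator (α β γ : k) :
    agen k α β γ 0 * agen k α β γ 1 + agen k α β γ 1 * agen k α β γ 0 =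
      agen k α β γ 2 * agen k α β γ 3 - agen k α β γ 3 * agen k α β γ 2 := by
  have h := RingQuot.mkAlgHom_rel k (s := fourRel k α β γ) ⟨rfl, Or.inr (Or.inl rfl)⟩
  rw [map_zero] at h
  simpa [agen, sub_eq_zero] using h

/-- The four-dimensional Sklyanin algebras admit no first-order differential calculus whose
first-order forms are the free right module `A(α,β,γ)⁴` with `d xᵢ = eᵢ` and twisted left
module structure: there are no endomorphisms `ν₀,…,ν₃` and no `k`-linear `d` satisfying the
componentwise twisted Leibniz rule. -/
theorem sklyanin4_no_first_order_calculus (hchar : ringChar k ≠ 2) (α β γ : k) :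
    ¬ ∃ (ν : Fin 4 → (SklyA k α β γ →ₐ[k] SklyA k α β γ))
        (d : SklyA k α β γ →ₗ[k] (Fin 4 → SklyA k α β γ)),
      (∀ i : Fin 4, d (agen k α β γ i) = Pi.single i 1) ∧
      (∀ (a b : SklyA k α β γ) (j : Fin 4),
        d (a * b) j = d a j * b + (ν j) a * d b j) := by
  rintro ⟨ν, d, hd, hL⟩
  have h₁ := congrFun (congrArg d (agen_commutator k α β γ)) 0
  have h₂ := congrFun (congrArg d (agen_anticommutator k α β γ)) 0
  simp [hd, hL, sub_eq_zero] at h₁ h₂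
  rw [← h₁, ← two_smul k] at h₂
  exact (smul_ne_zero (Ring.two_ne_zero hchar) (agen_one_ne_zero k α β γ)) h₂
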